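/- Let p be a prime, r ≥ 2 an integer, and G the abelian group (ℤ/p^rℤ) × (ℤ/pℤ). Let T ≤ G be a subgroup of order p whose intersection with the Frattini subgroup Φ(G) is trivial, and let g ∈ G. Then: (i) if g has order p^r, then m_{G,g}^T = 0; (ii) if g ∈ Φ(G), then m_{G,g}^T = (1 − p)/p. -/

import Mathlib

open scoped Classical

/-- The Möbius function `μ(V, ⊤)` of a finite partial order with a top element,
characterized by `μ(⊤,⊤) = 1` and `∑_{V ≤ W ≤ ⊤} μ(W,⊤) = 0` for `V < ⊤`. -/
noncomputable def topMu {α : Type*} [PartialOrder α] [OrderTop α] [Fintype α] (V : α) : ℚ :=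
  if V = ⊤ then 1
  else - ∑ W : α, if _ : V < W then topMu W else 0
termination_by (Finset.univ.filter (fun W => V < W)).card
decreasing_by
  apply Finset.card_lt_card
  constructor
  · intro X hX
    simp only [Finset.mem_filter, Finset.mem_univ, true_and] at *
    exact lt_trans (by assumption) hX
  · intro hsub
    rename_i hVW
    have hW : W ∈ Finset.univ.filter (fun X => V < X) := by
      simp only [Finset.mem_filter, Finset.mem_univ, true_and]; exact hVW
    have := hsub hW
    simp only [Finset.mem_filter, Finset.mem_univ, true_and] at this
    exact lt_irrefl W this

/-- For a finite abelian group `G`, a subgroup `N ≤ G` and `g ∈ G`, the deflation number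
`m_{G,g}^N = (1/|N|) · ∑_{V ⊔ N = G, g ∈ V} μ(V, G)`. -/
noncomputable def deflationNumber {G : Type*} [CommGroup G] [Fintype G]
    (N : Subgroup G) (g : G) : ℚ :=
  (1 / (Nat.card N : ℚ)) *
    ∑ V ∈ Finset.univ.filter (fun V : Subgroup G => V ⊔ N = ⊤ ∧ g ∈ V), topMu V

theorem topMu_top {α : Type*} [PartialOrder α] [OrderTop α] [Fintype α] :
    topMu (⊤ : α) = 1 := by
  rw [topMu, if_pos rfl]

theorem topMu_of_isCoatom {α : Type*} [PartialOrder α] [OrderTop α] [Fintype α] {V : α}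
    (hV : IsCoatom V) : topMu V = -1 := by
  rw [topMu, if_neg hV.1, Finset.sum_eq_single ⊤]
  · simp [hV.lt_top, topMu_top]
  · intro W _ hW
    rw [dif_neg fun h => hW (hV.2 W h)]
  · simp

section PrimeOrder

variable {G : Type*} [CommGroup G] {p r : ℕ} {T V : Subgroup G}

theorem pow_mem_frattini_of_isPGroup (hG : IsPGroup p G) (x : G) : x ^ p ∈ frattini G := by
  simp only [frattini, Order.radical, Subgroup.mem_iInf]
  intro K hK
  by_contra hx
  have htop : K ⊔ Subgroup.zpowers (x ^ p) = ⊤ := by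
    refine hK.2 _ (lt_of_le_of_ne le_sup_left fun h => hx ?_)
    rw [h]
    exact Subgroup.mem_sup_right (Subgroup.mem_zpowers _)
  obtain ⟨k, hk, y, hy, hky⟩ := Subgroup.mem_sup.1 (htop ▸ Subgroup.mem_top x)
  obtain ⟨m, rfl⟩ := Subgroup.mem_zpowers_iff.1 hy
  obtain ⟨j, hj⟩ := hG x
  have hkx : k = x ^ (1 - p * m : ℤ) := by
    rw [zpow_sub, zpow_one, zpow_mul, zpow_natCast, eq_mul_inv_iff_mul_eq, hky]
  obtain ⟨a, b, hab⟩ : IsCoprime (1 - p * m : ℤ) ((p : ℤ) ^ j) :=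
    IsCoprime.pow_right ⟨1, m, by ring⟩
  have hxk : x = k ^ a := by
    calc x = x ^ (a * (1 - p * m) + b * (p : ℤ) ^ j : ℤ) := by rw [hab, zpow_one]
      _ = k ^ a := by
        have : x ^ ((p : ℤ) ^ j) = 1 := by exact_mod_cast hj
        rw [zpow_add, mul_comm a, zpow_mul, ← hkx, mul_comm b, zpow_mul, this, one_zpow, mul_one]
  exact hx (K.pow_mem (hxk ▸ K.zpow_mem hk a) p)

variable [Fact p.Prime]

theorem Subgroup.index_eq_of_sup_eq_top (hT : Nat.card T = p) (hVT : V ⊔ T = ⊤) (hV : V ≠ ⊤) :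
    V.index = p := by
  have hp : p.Prime := Fact.out
  have h : V.index = V.relIndex T := by
    rw [← Subgroup.relIndex_top_right, ← hVT, Subgroup.relIndex_sup_left]
  rcases (Nat.dvd_prime hp).1 (hT ▸ h ▸ Subgroup.relIndex_dvd_card V T) with h | h
  · exact absurd (Subgroup.index_eq_one.1 h) hV
  · exact h

theorem index_zpowers (hG : Nat.card G = p ^ (r + 1)) {x : G} (hx : orderOf x = p ^ r) :
    (Subgroup.zpowers x).index = p := by
  have hp : p.Prime := Fact.out
  have h := (Subgroup.zpowers x).card_mul_index
  rw [Nat.card_zpowers, hx, hG, pow_succ] at h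
  exact Nat.eq_of_mul_eq_mul_left (pow_pos hp.pos r) h

theorem orderOf_mul_of_mem (hr : 2 ≤ r) (hT : Nat.card T = p) {e s : G}
    (he : orderOf e = p ^ r) (hs : s ∈ T) : orderOf (e * s) = p ^ r := by
  have hp : p.Prime := Fact.out
  have hsp : s ^ p = 1 := by
    have := pow_card_eq_one' (x := (⟨s, hs⟩ : T))
    rw [hT] at this
    exact congrArg Subtype.val this
  have key : ∀ n, 1 ≤ n → (e * s) ^ p ^ n = e ^ p ^ n := by
    intro n hn
    rw [mul_pow, ← Nat.sub_add_cancel hn, pow_succ' p, pow_mul s, hsp, one_pow, mul_one]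
  obtain ⟨n, rfl⟩ : ∃ n, r = n + 1 := ⟨r - 1, by omega⟩
  refine orderOf_eq_prime_pow ?_ ?_
  · rw [key n (by omega)]
    intro h
    have := Nat.le_of_dvd (pow_pos hp.pos n) (he ▸ orderOf_dvd_of_pow_eq_one h)
    exact absurd this (not_le.2 (Nat.pow_lt_pow_right hp.one_lt (by omega)))
  · rw [key _ (by omega), ← he, pow_orderOf_eq_one]

theorem inf_zpowers_eq_bot (hG : IsPGroup p G) (hr : 2 ≤ r) (hT : Nat.card T = p)
    (hTΦ : T ⊓ frattini G = ⊥) {x : G} (hx : orderOf x = p ^ r) :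
    T ⊓ Subgroup.zpowers x = ⊥ := by
  have hp : p.Prime := Fact.out
  rw [eq_bot_iff]
  rintro t ⟨ht, htx⟩
  obtain ⟨k, rfl⟩ := Subgroup.mem_zpowers_iff.1 htx
  have h1 : (x ^ k) ^ p = 1 := by
    have := pow_card_eq_one' (x := (⟨x ^ k, ht⟩ : T))
    rw [hT] at this
    exact congrArg Subtype.val this
  have hdvd : (p : ℤ) ∣ k := by
    rw [← zpow_natCast, ← zpow_mul, ← orderOf_dvd_iff_zpow_eq_one, hx] at h1
    have h2 : (p : ℤ) * p ∣ k * p := by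
      refine dvd_trans ?_ h1
      rw [← sq]
      exact_mod_cast pow_dvd_pow p hr
    exact Int.dvd_of_mul_dvd_mul_right (by exact_mod_cast hp.ne_zero) h2
  obtain ⟨m, rfl⟩ := hdvd
  rw [← hTΦ]
  refine ⟨ht, ?_⟩
  rw [mul_comm, zpow_mul, zpow_natCast]
  exact pow_mem_frattini_of_isPGroup hG _

section Finite

variable [Finite G]

theorem Subgroup.isCoatom_of_index_prime (hV : V.index = p) : IsCoatom V := by
  have hp : p.Prime := Fact.out
  refine ⟨fun h => hp.one_lt.ne' (by rw [← hV, h, Subgroup.index_top]), fun W hW => ?_⟩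
  rcases (Nat.dvd_prime hp).1 (hV ▸ Subgroup.index_dvd_of_le hW.le) with h | h
  · exact Subgroup.index_eq_one.1 h
  · refine absurd (Subgroup.eq_of_le_of_card_ge hW.le ?_) hW.ne
    have hv := V.card_mul_index
    rw [← W.card_mul_index, hV, h] at hv
    exact (Nat.eq_of_mul_eq_mul_right hp.pos hv).ge

theorem zpowers_sup_eq_top (hG : Nat.card G = p ^ (r + 1)) (hr : 2 ≤ r) (hT : Nat.card T = p)
    (hTΦ : T ⊓ frattini G = ⊥) {x : G} (hx : orderOf x = p ^ r) :
    Subgroup.zpowers x ⊔ T = ⊤ := by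
  have hp : p.Prime := Fact.out
  refine (Subgroup.isCoatom_of_index_prime (index_zpowers hG hx)).2 _
    (lt_of_le_of_ne le_sup_left fun h => ?_)
  have h1 := inf_zpowers_eq_bot (IsPGroup.of_card hG) hr hT hTΦ hx
  rw [inf_eq_left.2 (h ▸ le_sup_right)] at h1
  rw [h1, Subgroup.card_bot] at hT
  exact hp.one_lt.ne hT

theorem eq_zpowers_of_mem (hG : Nat.card G = p ^ (r + 1))
    {x : G} (hx : orderOf x = p ^ r) (hV : V ≠ ⊤) (hxV : x ∈ V) :
    V = Subgroup.zpowers x := by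
  have hle : Subgroup.zpowers x ≤ V := by simpa using hxV
  by_contra hne
  exact hV ((Subgroup.isCoatom_of_index_prime (index_zpowers hG hx)).2 V
    (lt_of_le_of_ne hle (Ne.symm hne)))

end Finite

variable [Fintype G]

theorem deflationNumber_eq_of_card_prime (hT : Nat.card T = p) (g : G) :
    deflationNumber T g =
      (1 - ((Finset.univ.filter fun V : Subgroup G => (V ⊔ T = ⊤ ∧ V ≠ ⊤) ∧ g ∈ V).card : ℚ))
        / p := by
  have hS : (Finset.univ.filter fun V : Subgroup G => V ⊔ T = ⊤ ∧ g ∈ V) =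
      insert ⊤ (Finset.univ.filter fun V : Subgroup G => (V ⊔ T = ⊤ ∧ V ≠ ⊤) ∧ g ∈ V) := by
    ext V
    by_cases hV : V = ⊤ <;> simp [hV]
  have hsum : ∑ V ∈ Finset.univ.filter (fun V : Subgroup G => (V ⊔ T = ⊤ ∧ V ≠ ⊤) ∧ g ∈ V),
      topMu V =
        ∑ V ∈ Finset.univ.filter (fun V : Subgroup G => (V ⊔ T = ⊤ ∧ V ≠ ⊤) ∧ g ∈ V), -1 := by
    refine Finset.sum_congr rfl fun V hV => ?_
    obtain ⟨⟨hVT, hV⟩, -⟩ := (Finset.mem_filter.1 hV).2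
    exact topMu_of_isCoatom
      (Subgroup.isCoatom_of_index_prime (Subgroup.index_eq_of_sup_eq_top hT hVT hV))
  rw [deflationNumber, hS, Finset.sum_insert (by simp), hsum, topMu_top, hT]
  simp only [Finset.sum_const, nsmul_eq_mul]
  ring

theorem deflationNumber_eq_zero_of_orderOf (hG : Nat.card G = p ^ (r + 1)) (hr : 2 ≤ r)
    (hT : Nat.card T = p) (hTΦ : T ⊓ frattini G = ⊥) {g : G} (hg : orderOf g = p ^ r) :
    deflationNumber T g = 0 := by
  have hS : (Finset.univ.filter fun V : Subgroup G => (V ⊔ T = ⊤ ∧ V ≠ ⊤) ∧ g ∈ V) =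
      {Subgroup.zpowers g} := by
    ext V
    simp only [Finset.mem_filter, Finset.mem_univ, true_and, Finset.mem_singleton]
    constructor
    · rintro ⟨⟨hVT, hV⟩, hgV⟩
      exact eq_zpowers_of_mem hG hg hV hgV
    · rintro rfl
      exact ⟨⟨zpowers_sup_eq_top hG hr hT hTΦ hg,
        (Subgroup.isCoatom_of_index_prime (index_zpowers hG hg)).1⟩, Subgroup.mem_zpowers g⟩
  rw [deflationNumber_eq_of_card_prime hT, hS]
  simp

theorem deflationNumber_eq_of_mem_frattini (hG : Nat.card G = p ^ (r + 1)) (hr : 2 ≤ r)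
    (hT : Nat.card T = p) (hTΦ : T ⊓ frattini G = ⊥) {e g : G} (he : orderOf e = p ^ r)
    (hg : g ∈ frattini G) : deflationNumber T g = (1 - (p : ℚ)) / p := by
  have hS : (Finset.univ.filter fun V : Subgroup G => (V ⊔ T = ⊤ ∧ V ≠ ⊤) ∧ g ∈ V) =
      Finset.univ.image fun s : T => Subgroup.zpowers (e * s) := by
    ext V
    simp only [Finset.mem_filter, Finset.mem_univ, true_and, Finset.mem_image]
    constructor
    · rintro ⟨⟨hVT, hV⟩, -⟩
      obtain ⟨v, hv, t, ht, hvt⟩ := Subgroup.mem_sup.1 (hVT ▸ Subgroup.mem_top e)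
      refine ⟨⟨t⁻¹, T.inv_mem ht⟩, ?_⟩
      have hv' : e * t⁻¹ = v := by rw [← hvt, mul_inv_cancel_right]
      exact (eq_zpowers_of_mem hG (orderOf_mul_of_mem hr hT he (T.inv_mem ht)) hV
        (hv' ▸ hv)).symm
    · rintro ⟨s, rfl⟩
      have hes := orderOf_mul_of_mem hr hT he s.2
      have hco := Subgroup.isCoatom_of_index_prime (index_zpowers hG hes)
      exact ⟨⟨zpowers_sup_eq_top hG hr hT hTΦ hes, hco.1⟩, frattini_le_coatom hco hg⟩
  have hinj : Function.Injective fun s : T => Subgroup.zpowers (e * (s : G)) := by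
    intro s t hst
    have hs : e * (s : G) ∈ Subgroup.zpowers (e * (t : G)) := by
      dsimp only at hst
      rw [← hst]
      exact Subgroup.mem_zpowers _
    have hmem : (s : G) * (t : G)⁻¹ ∈ T ⊓ Subgroup.zpowers (e * (t : G)) := by
      refine ⟨T.mul_mem s.2 (T.inv_mem t.2), ?_⟩
      have := Subgroup.mul_mem _ hs (Subgroup.inv_mem _ (Subgroup.mem_zpowers (e * (t : G))))
      rwa [mul_inv, mul_mul_mul_comm, mul_inv_cancel, one_mul] at this
    rw [inf_zpowers_eq_bot (IsPGroup.of_card hG) hr hT hTΦ (orderOf_mul_of_mem hr hT he t.2),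
      Subgroup.mem_bot, mul_inv_eq_one] at hmem
    exact Subtype.ext hmem
  rw [deflationNumber_eq_of_card_prime hT, hS, Finset.card_image_of_injective _ hinj,
    Finset.card_univ, ← Nat.card_eq_fintype_card, hT]

end PrimeOrder

/-- Deflation numbers for `G = C_{p^r} × C_p` (`r ≥ 2`) at a subgroup `T` of order `p`
intersecting the Frattini subgroup trivially: if `g` has order `p^r` then `m_{G,g}^T = 0`,
and if `g ∈ Φ(G)` then `m_{G,g}^T = (1-p)/p`. -/
theorem deflation_number_cpr_cp
    (p r : ℕ) [Fact p.Prime] (hr : 2 ≤ r)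
    (T : Subgroup (Multiplicative (ZMod (p ^ r) × ZMod p)))
    (hT : Nat.card T = p)
    (hTΦ : T ⊓ frattini (Multiplicative (ZMod (p ^ r) × ZMod p)) = ⊥)
    (g : Multiplicative (ZMod (p ^ r) × ZMod p)) :
    (orderOf g = p ^ r → deflationNumber T g = 0) ∧
    (g ∈ frattini (Multiplicative (ZMod (p ^ r) × ZMod p)) →
      deflationNumber T g = (1 - (p : ℚ)) / p) := by
  have hp : p.Prime := Fact.out
  have hG : Nat.card (Multiplicative (ZMod (p ^ r) × ZMod p)) = p ^ (r + 1) := by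
    rw [Nat.card_congr Multiplicative.toAdd, Nat.card_prod, Nat.card_zmod, Nat.card_zmod, pow_succ]
  have he : orderOf (Multiplicative.ofAdd ((1, 0) : ZMod (p ^ r) × ZMod p)) = p ^ r := by
    rw [orderOf_ofAdd_eq_addOrderOf, Prod.addOrderOf_mk, ZMod.addOrderOf_one, addOrderOf_zero,
      Nat.lcm_one_right]
  exact ⟨deflationNumber_eq_zero_of_orderOf hG hr hT hTΦ,
    deflationNumber_eq_of_mem_frattini hG hr hT hTΦ he⟩
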